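/- (Basic energy estimate, Proposition 3.1.) There exists a positive constant R₀ (depending only on the Korn constant K) such that if 0<R≤R₀, then any sufficiently smooth solution (η,u,v,p) of the transformed system satisfies (δ/2) d/dt { ‖u^δ‖² + (2/R)( (1/tan α)|η|₀² + (δ²W/sin α)|η_x|₀² ) } + (1/(4KR)) ‖∇_δ u^δ‖² ≤ (4K/R)( |η|₀² + |b₃η|₀² ) + (1/R)(h₁, u)_Γ − (2/R)(h₂, δv)_Γ + (2/R)( (1/tan α)η − (δ²W/sin α)η_{xx}, δ h₃ )_Γ + (F₁, u^δ)_Ω, where F₁ = f − (2/R) A₄∇_δ p + (1/R)(b₂ u_{yy}, 0)ᵀ and K is the constant of Korn's inequality on Ω. -/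

import Mathlib

open MeasureTheory Real

noncomputable section

/-- Functions on `Ω × ℝ_t`, `Ω = 𝕋 × (0,1)` (the torus `𝕋 = ℝ/ℤ` is modelled by
`1`-periodic functions of `x`); arguments `(x, y, t)`. -/
abbrev OF : Type := ℝ → ℝ → ℝ → ℝ
/-- Functions on `Γ × ℝ_t`; arguments `(x, t)`. -/
abbrev GF : Type := ℝ → ℝ → ℝ

def pdx (f : OF) : OF := fun x y t => deriv (fun s => f s y t) x
def pdy (f : OF) : OF := fun x y t => deriv (fun s => f x s t) y
def pdt (f : OF) : OF := fun x y t => deriv (fun s => f x y s) t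
def pdxn (n : ℕ) (f : OF) : OF := pdx^[n] f
def pdyn (n : ℕ) (f : OF) : OF := pdy^[n] f
def gdx (g : GF) : GF := fun x t => deriv (fun s => g s t) x
def gdt (g : GF) : GF := fun x t => deriv (fun s => g x s) t
def gdxn (n : ℕ) (g : GF) : GF := gdx^[n] g

/-- Squared `L²(Ω)` norm at time `t`. -/
def nO (f : OF) (t : ℝ) : ℝ := ∫ x in (0:ℝ)..1, ∫ y in (0:ℝ)..1, (f x y t)^2
/-- Squared `L²(Γ)` norm at time `t`. -/
def nG (g : GF) (t : ℝ) : ℝ := ∫ x in (0:ℝ)..1, (g x t)^2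
/-- `L²(Ω)` inner product at time `t`. -/
def ipO (f g : OF) (t : ℝ) : ℝ := ∫ x in (0:ℝ)..1, ∫ y in (0:ℝ)..1, f x y t * g x y t
/-- `L²(Γ)` inner product at time `t`. -/
def ipG (f g : GF) (t : ℝ) : ℝ := ∫ x in (0:ℝ)..1, f x t * g x t
/-- Trace on `Γ = {y = 1}`. -/
def tr (f : OF) : GF := fun x t => f x 1 t
/-- `∂_y^{-1} f(x,y,t) = −∫_y^1 f(x,z,t) dz`. -/
def iy (f : OF) : OF := fun x y t => -∫ z in y..1, f x z t

/-- "Sufficiently smooth": jointly smooth and `1`-periodic in `x`. -/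
def SmoothO (f : OF) : Prop :=
  (∀ n : ℕ, ContDiff ℝ n (fun q : ℝ × ℝ × ℝ => f q.1 q.2.1 q.2.2)) ∧
    ∀ y t : ℝ, Function.Periodic (fun x => f x y t) 1
def SmoothG (g : GF) : Prop :=
  (∀ n : ℕ, ContDiff ℝ n (fun q : ℝ × ℝ => g q.1 q.2)) ∧
    ∀ t : ℝ, Function.Periodic (fun x => g x t) 1

/-- `n`-th Fourier coefficient in `x` of a `Γ`-function at time `t`. -/
def fcG (g : GF) (t : ℝ) (n : ℤ) : ℂ :=
  ∫ x in (0:ℝ)..1, Complex.exp (-(2 * π * (n : ℝ) * x : ℝ) * Complex.I) * (g x t : ℂ)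
/-- `n`-th Fourier coefficient in `x` of an `Ω`-function at height `y`, time `t`. -/
def fcO (f : OF) (y t : ℝ) (n : ℤ) : ℂ :=
  ∫ x in (0:ℝ)..1, Complex.exp (-(2 * π * (n : ℝ) * x : ℝ) * Complex.I) * (f x y t : ℂ)

/-- The symbol `2π|n|` of the Fourier multiplier `|D_x|`. -/
def tp (n : ℤ) : ℝ := 2 * π * |(n : ℝ)|
/-- Squared weighted (Fourier multiplier) trace norm on `Γ`. -/
def wG (w : ℤ → ℝ) (g : GF) (t : ℝ) : ℝ := ∑' n : ℤ, (w n)^2 * ‖fcG g t n‖^2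
/-- Squared weighted (Fourier multiplier in `x`) norm on `Ω`. -/
def wO (w : ℤ → ℝ) (f : OF) (t : ℝ) : ℝ :=
  ∫ y in (0:ℝ)..1, ∑' n : ℤ, (w n)^2 * ‖fcO f y t n‖^2
/-- The `H^m(𝔾)` weight `(1 + (2πn)²)^{m/2}`. -/
def hwt (m : ℕ) (n : ℤ) : ℝ := (Real.sqrt (1 + (2 * π * (n : ℝ))^2))^m

/-- The transformed film-flow system (2.20)–(2.22): the linear part is written out
explicitly (with `U = (2y−y²,0)ᵀ`, `u^δ = (u,δv)ᵀ`), and the nonlinear terms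
`A₄ = (aᵢⱼ)` (symmetric), `A₃ = diag(b₂,0)`, `f = (f₁,f₂)ᵀ`, `b₃`, `h₁`, `h₂`, `h₃`
are given functions. -/
structure FilmSystem (δ R W α : ℝ) (η : GF) (u v p : OF)
    (a11 a12 a22 b2 : OF) (f1 f2 : OF) (b3 h1 h2 h3 : GF) : Prop where
  smooth_η : SmoothG η
  smooth_u : SmoothO u
  smooth_v : SmoothO v
  smooth_p : SmoothO p
  smooth_a11 : SmoothO a11
  smooth_a12 : SmoothO a12
  smooth_a22 : SmoothO a22
  smooth_b2 : SmoothO b2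
  smooth_f1 : SmoothO f1
  smooth_f2 : SmoothO f2
  smooth_b3 : SmoothG b3
  smooth_h1 : SmoothG h1
  smooth_h2 : SmoothG h2
  smooth_h3 : SmoothG h3
  /-- first component of the momentum equation -/
  mom1 : ∀ x t : ℝ, ∀ y ∈ Set.Ioo (0:ℝ) 1,
    δ * pdt u x y t + (2*y - y^2) * (δ * pdx u x y t) + (2 - 2*y) * (δ * v x y t)
      + (2/R) * ((1 + a11 x y t) * (δ * pdx p x y t) + a12 x y t * pdy p x y t)
      - (1/R) * (δ^2 * pdxn 2 u x y t + (1 + b2 x y t) * pdyn 2 u x y t) = f1 x y t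
  /-- second component of the momentum equation -/
  mom2 : ∀ x t : ℝ, ∀ y ∈ Set.Ioo (0:ℝ) 1,
    δ^2 * pdt v x y t + (2*y - y^2) * (δ^2 * pdx v x y t)
      + (2/R) * (a12 x y t * (δ * pdx p x y t) + (1 + a22 x y t) * pdy p x y t)
      - (1/R) * (δ^3 * pdxn 2 v x y t + δ * pdyn 2 v x y t) = f2 x y t
  /-- incompressibility -/
  incompr : ∀ x t : ℝ, ∀ y ∈ Set.Ioo (0:ℝ) 1, pdx u x y t + pdy v x y t = 0
  /-- tangential stress boundary condition on `Γ` -/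
  bc1 : ∀ x t : ℝ, δ^2 * pdx v x 1 t + pdy u x 1 t - (2 + b3 x t) * η x t = h1 x t
  /-- normal stress boundary condition on `Γ` -/
  bc2 : ∀ x t : ℝ, p x 1 t - δ * pdy v x 1 t - (1/Real.tan α) * η x t
      + (δ^2 * W / Real.sin α) * gdxn 2 η x t = h2 x t
  /-- kinematic boundary condition on `Γ` -/
  bc3 : ∀ x t : ℝ, gdt η x t + gdx η x t - v x 1 t = h3 x t
  /-- no-slip condition on `Σ` -/
  noslip : ∀ x t : ℝ, u x 0 t = 0 ∧ v x 0 t = 0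

/-- `K` is a Korn constant for `Ω` (Lemma 3.1), uniformly in `0 < δ ≤ 1`. -/
def KornConst (K : ℝ) : Prop :=
  0 < K ∧ ∀ δ : ℝ, δ ∈ Set.Ioc (0:ℝ) 1 → ∀ u v : OF, SmoothO u → SmoothO v →
    (∀ x t : ℝ, ∀ y ∈ Set.Ioo (0:ℝ) 1, pdx u x y t + pdy v x y t = 0) →
    (∀ x t : ℝ, u x 0 t = 0 ∧ v x 0 t = 0) →
    ∀ t : ℝ,
      δ^2 * nO (pdx u) t + nO (pdy u) t + δ^4 * nO (pdx v) t + δ^2 * nO (pdy v) t ≤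
        K * (2 * δ^2 * nO (pdx u) t
          + nO (fun x y s => pdy u x y s + δ^2 * pdx v x y s) t
          + 2 * δ^2 * nO (pdy v) t)

theorem intervalIntegral_swap_of_continuous {f : ℝ → ℝ → ℝ}
    (hf : Continuous (Function.uncurry f)) {a b c d : ℝ} :
    ∫ x in a..b, ∫ y in c..d, f x y = ∫ y in c..d, ∫ x in a..b, f x y := by
  simp only [intervalIntegral.intervalIntegral_eq_integral_uIoc, integral_smul]
  rw [smul_comm]
  congr 2
  apply integral_integral_swap
  rw [Measure.prod_restrict, ← IntegrableOn]
  exact (hf.continuousOn.integrableOn_compact (isCompact_uIcc.prod isCompact_uIcc)).mono_set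
    (Set.prod_mono Set.uIoc_subset_uIcc Set.uIoc_subset_uIcc)

theorem hasDerivAt_intervalIntegral_of_continuous {f f' : ℝ → ℝ → ℝ} {a b : ℝ}
    (hf : ∀ t, Continuous fun x => f x t) (hf' : Continuous fun q : ℝ × ℝ => f' q.1 q.2)
    (h : ∀ x t, HasDerivAt (fun s => f x s) (f' x t) t) (t : ℝ) :
    HasDerivAt (fun s => ∫ x in a..b, f x s) (∫ x in a..b, f' x t) t := by
  obtain ⟨C, hC⟩ := (isCompact_uIcc.prod (isCompact_closedBall t 1)).exists_bound_of_continuousOn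
    (f := fun q : ℝ × ℝ => f' q.1 q.2) (s := Set.uIcc a b ×ˢ Metric.closedBall t 1)
    hf'.continuousOn
  refine (intervalIntegral.hasDerivAt_integral_of_dominated_loc_of_deriv_le
    (F := fun s x => f x s) (F' := fun s x => f' x s) (bound := fun _ => C)
    (Metric.closedBall_mem_nhds t one_pos)
    (Filter.Eventually.of_forall fun s => (hf s).aestronglyMeasurable)
    ((hf t).intervalIntegrable _ _)
    (Continuous.aestronglyMeasurable
      (hf'.comp (by fun_prop : Continuous fun x : ℝ => ((x, t) : ℝ × ℝ))))
    (Filter.Eventually.of_forall fun x hx s hs =>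
      hC (x, s) ⟨Set.uIoc_subset_uIcc hx, hs⟩)
    intervalIntegrable_const
    (Filter.Eventually.of_forall fun x _ s _ => h x s)).2

/-- The integral over `Ω` at time `t`. -/
def intO (f : OF) (t : ℝ) : ℝ := ∫ x in (0:ℝ)..1, ∫ y in (0:ℝ)..1, f x y t

namespace SmoothO

variable {f g : OF}

theorem contDiff_infty (hf : SmoothO f) :
    ContDiff ℝ (⊤ : ℕ∞) (fun q : ℝ × ℝ × ℝ => f q.1 q.2.1 q.2.2) :=
  _root_.contDiff_infty.2 hf.1

theorem of_contDiff (h : ContDiff ℝ (⊤ : ℕ∞) (fun q : ℝ × ℝ × ℝ => f q.1 q.2.1 q.2.2))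
    (hp : ∀ x y t, f (x + 1) y t = f x y t) : SmoothO f :=
  ⟨_root_.contDiff_infty.1 h, fun y t x => hp x y t⟩

theorem periodic (hf : SmoothO f) (x y t : ℝ) : f (x + 1) y t = f x y t := hf.2 y t x

theorem continuous (hf : SmoothO f) :
    Continuous (fun q : ℝ × ℝ × ℝ => f q.1 q.2.1 q.2.2) :=
  hf.contDiff_infty.continuous

theorem continuous_y (hf : SmoothO f) (x t : ℝ) : Continuous fun y => f x y t :=
  hf.continuous.comp (by fun_prop : Continuous fun y : ℝ => ((x, y, t) : ℝ × ℝ × ℝ))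

theorem continuous_inner (hf : SmoothO f) :
    Continuous fun q : ℝ × ℝ => ∫ y in (0:ℝ)..1, f q.1 y q.2 := by
  apply intervalIntegral.continuous_parametric_intervalIntegral_of_continuous'
  exact hf.continuous.comp
    (by fun_prop : Continuous fun q : (ℝ × ℝ) × ℝ => ((q.1.1, q.2, q.1.2) : ℝ × ℝ × ℝ))

theorem continuous_inner_x (hf : SmoothO f) (t : ℝ) :
    Continuous fun x : ℝ => ∫ y in (0:ℝ)..1, f x y t :=
  hf.continuous_inner.comp (by fun_prop : Continuous fun x : ℝ => ((x, t) : ℝ × ℝ))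

theorem const (c : ℝ) : SmoothO fun _ _ _ => c :=
  of_contDiff contDiff_const fun _ _ _ => rfl

theorem coord_y : SmoothO fun _ y _ => y :=
  of_contDiff (by fun_prop) fun _ _ _ => rfl

theorem of_boundary {g : GF} (hg : SmoothG g) : SmoothO fun x _ t => g x t :=
  of_contDiff ((_root_.contDiff_infty.2 hg.1).comp
    (by fun_prop : ContDiff ℝ (⊤ : ℕ∞) fun q : ℝ × ℝ × ℝ => ((q.1, q.2.2) : ℝ × ℝ)))
    fun x _ t => hg.2 t x

theorem trace (hf : SmoothO f) (c : ℝ) : SmoothO fun x _ t => f x c t :=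
  of_contDiff (hf.contDiff_infty.comp
    (by fun_prop : ContDiff ℝ (⊤ : ℕ∞) fun q : ℝ × ℝ × ℝ => ((q.1, c, q.2.2) : ℝ × ℝ × ℝ)))
    fun x _ t => hf.2 c t x

theorem add (hf : SmoothO f) (hg : SmoothO g) : SmoothO fun x y t => f x y t + g x y t :=
  of_contDiff (hf.contDiff_infty.add hg.contDiff_infty)
    fun x y t => by rw [hf.periodic, hg.periodic]

theorem sub (hf : SmoothO f) (hg : SmoothO g) : SmoothO fun x y t => f x y t - g x y t :=
  of_contDiff (hf.contDiff_infty.sub hg.contDiff_infty)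
    fun x y t => by rw [hf.periodic, hg.periodic]

theorem mul (hf : SmoothO f) (hg : SmoothO g) : SmoothO fun x y t => f x y t * g x y t :=
  of_contDiff (hf.contDiff_infty.mul hg.contDiff_infty)
    fun x y t => by rw [hf.periodic, hg.periodic]

theorem pow (hf : SmoothO f) (n : ℕ) : SmoothO fun x y t => f x y t ^ n :=
  of_contDiff (hf.contDiff_infty.pow n) fun x y t => by rw [hf.periodic]

theorem hasFDerivAt (hf : SmoothO f) (q : ℝ × ℝ × ℝ) :
    HasFDerivAt (fun q : ℝ × ℝ × ℝ => f q.1 q.2.1 q.2.2)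
      (fderiv ℝ (fun q : ℝ × ℝ × ℝ => f q.1 q.2.1 q.2.2) q) q :=
  (hf.contDiff_infty.differentiable (by simp) q).hasFDerivAt

theorem hasDerivAt_x_fderiv (hf : SmoothO f) (x y t : ℝ) :
    HasDerivAt (fun s => f s y t)
      (fderiv ℝ (fun q : ℝ × ℝ × ℝ => f q.1 q.2.1 q.2.2) (x, y, t) (1, 0, 0)) x :=
  HasFDerivAt.comp_hasDerivAt (f := fun s : ℝ => (s, y, t)) x (hf.hasFDerivAt (x, y, t))
    ((hasDerivAt_id x).prodMk ((hasDerivAt_const x y).prodMk (hasDerivAt_const x t)))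

theorem hasDerivAt_y_fderiv (hf : SmoothO f) (x y t : ℝ) :
    HasDerivAt (fun s => f x s t)
      (fderiv ℝ (fun q : ℝ × ℝ × ℝ => f q.1 q.2.1 q.2.2) (x, y, t) (0, 1, 0)) y :=
  HasFDerivAt.comp_hasDerivAt (f := fun s : ℝ => (x, s, t)) y (hf.hasFDerivAt (x, y, t))
    ((hasDerivAt_const y x).prodMk ((hasDerivAt_id y).prodMk (hasDerivAt_const y t)))

theorem hasDerivAt_t_fderiv (hf : SmoothO f) (x y t : ℝ) :
    HasDerivAt (fun s => f x y s)
      (fderiv ℝ (fun q : ℝ × ℝ × ℝ => f q.1 q.2.1 q.2.2) (x, y, t) (0, 0, 1)) t :=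
  HasFDerivAt.comp_hasDerivAt (f := fun s : ℝ => (x, y, s)) t (hf.hasFDerivAt (x, y, t))
    ((hasDerivAt_const t x).prodMk ((hasDerivAt_const t y).prodMk (hasDerivAt_id t)))

theorem hasDerivAt_x (hf : SmoothO f) (x y t : ℝ) :
    HasDerivAt (fun s => f s y t) (pdx f x y t) x :=
  (hf.hasDerivAt_x_fderiv x y t).differentiableAt.hasDerivAt

theorem hasDerivAt_y (hf : SmoothO f) (x y t : ℝ) :
    HasDerivAt (fun s => f x s t) (pdy f x y t) y :=
  (hf.hasDerivAt_y_fderiv x y t).differentiableAt.hasDerivAt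

theorem hasDerivAt_t (hf : SmoothO f) (x y t : ℝ) :
    HasDerivAt (fun s => f x y s) (pdt f x y t) t :=
  (hf.hasDerivAt_t_fderiv x y t).differentiableAt.hasDerivAt

theorem pdx_eq_fderiv (hf : SmoothO f) (x y t : ℝ) : pdx f x y t =
    fderiv ℝ (fun q : ℝ × ℝ × ℝ => f q.1 q.2.1 q.2.2) (x, y, t) (1, 0, 0) :=
  (hf.hasDerivAt_x_fderiv x y t).deriv

theorem pdy_eq_fderiv (hf : SmoothO f) (x y t : ℝ) : pdy f x y t =
    fderiv ℝ (fun q : ℝ × ℝ × ℝ => f q.1 q.2.1 q.2.2) (x, y, t) (0, 1, 0) :=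
  (hf.hasDerivAt_y_fderiv x y t).deriv

theorem pdt_eq_fderiv (hf : SmoothO f) (x y t : ℝ) : pdt f x y t =
    fderiv ℝ (fun q : ℝ × ℝ × ℝ => f q.1 q.2.1 q.2.2) (x, y, t) (0, 0, 1) :=
  (hf.hasDerivAt_t_fderiv x y t).deriv

theorem contDiff_fderiv (hf : SmoothO f) :
    ContDiff ℝ (⊤ : ℕ∞) (fderiv ℝ (fun q : ℝ × ℝ × ℝ => f q.1 q.2.1 q.2.2)) :=
  hf.contDiff_infty.fderiv_right le_rfl

theorem contDiff_fderiv_apply (hf : SmoothO f) (e : ℝ × ℝ × ℝ) :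
    ContDiff ℝ (⊤ : ℕ∞)
      (fun q => fderiv ℝ (fun q : ℝ × ℝ × ℝ => f q.1 q.2.1 q.2.2) q e) :=
  hf.contDiff_fderiv.clm_apply contDiff_const

theorem pdx (hf : SmoothO f) : SmoothO (pdx f) :=
  of_contDiff (by simpa only [hf.pdx_eq_fderiv] using hf.contDiff_fderiv_apply (1, 0, 0))
    fun x y t => by
      have h : (fun s => f (s + 1) y t) = fun s => f s y t := funext fun s => hf.periodic s y t
      unfold _root_.pdx
      rw [← deriv_comp_add_const (fun s => f s y t) 1 x, h]

theorem pdy (hf : SmoothO f) : SmoothO (pdy f) :=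
  of_contDiff (by simpa only [hf.pdy_eq_fderiv] using hf.contDiff_fderiv_apply (0, 1, 0))
    fun x y t => by simp only [_root_.pdy, hf.periodic]

theorem pdt (hf : SmoothO f) : SmoothO (pdt f) :=
  of_contDiff (by simpa only [hf.pdt_eq_fderiv] using hf.contDiff_fderiv_apply (0, 0, 1))
    fun x y t => by simp only [_root_.pdt, hf.periodic]

theorem fderiv_fderiv_apply (hf : SmoothO f) (q e e' : ℝ × ℝ × ℝ) :
    fderiv ℝ (fun q => fderiv ℝ (fun q : ℝ × ℝ × ℝ => f q.1 q.2.1 q.2.2) q e) q e' =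
      fderiv ℝ (fderiv ℝ (fun q : ℝ × ℝ × ℝ => f q.1 q.2.1 q.2.2)) q e' e := by
  have h := ((hf.contDiff_fderiv.differentiable (by simp) q).hasFDerivAt.clm_apply
    (hasFDerivAt_const e q)).fderiv
  rw [h]
  simp

theorem fderiv_fderiv_comm (hf : SmoothO f) (q e e' : ℝ × ℝ × ℝ) :
    fderiv ℝ (fun q => fderiv ℝ (fun q : ℝ × ℝ × ℝ => f q.1 q.2.1 q.2.2) q e) q e' =
      fderiv ℝ (fun q => fderiv ℝ (fun q : ℝ × ℝ × ℝ => f q.1 q.2.1 q.2.2) q e') q e := by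
  rw [hf.fderiv_fderiv_apply, hf.fderiv_fderiv_apply]
  exact (hf.contDiff_infty.contDiffAt.isSymmSndFDerivAt
    (minSmoothness_of_isRCLikeNormedField.trans_le (WithTop.coe_le_coe.2 (le_top : (2 : ℕ∞) ≤ ⊤)))).eq _ _

theorem pdy_pdx (hf : SmoothO f) (x y t : ℝ) :
    _root_.pdy (_root_.pdx f) x y t = _root_.pdx (_root_.pdy f) x y t := by
  rw [hf.pdx.pdy_eq_fderiv, hf.pdy.pdx_eq_fderiv]
  simp only [hf.pdx_eq_fderiv, hf.pdy_eq_fderiv]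
  exact hf.fderiv_fderiv_comm _ _ _

theorem pdt_pdx (hf : SmoothO f) (x y t : ℝ) :
    _root_.pdt (_root_.pdx f) x y t = _root_.pdx (_root_.pdt f) x y t := by
  rw [hf.pdx.pdt_eq_fderiv, hf.pdt.pdx_eq_fderiv]
  simp only [hf.pdx_eq_fderiv, hf.pdt_eq_fderiv]
  exact hf.fderiv_fderiv_comm _ _ _

end SmoothO

section Integral

variable {f g : OF}

theorem intO_add (hf : SmoothO f) (hg : SmoothO g) (t : ℝ) :
    intO (fun x y s => f x y s + g x y s) t = intO f t + intO g t := by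
  unfold intO
  rw [← intervalIntegral.integral_add ((hf.continuous_inner_x t).intervalIntegrable _ _)
    ((hg.continuous_inner_x t).intervalIntegrable _ _)]
  congr 1
  ext x
  exact intervalIntegral.integral_add ((hf.continuous_y x t).intervalIntegrable _ _)
    ((hg.continuous_y x t).intervalIntegrable _ _)

theorem intO_sub (hf : SmoothO f) (hg : SmoothO g) (t : ℝ) :
    intO (fun x y s => f x y s - g x y s) t = intO f t - intO g t := by
  unfold intO
  rw [← intervalIntegral.integral_sub ((hf.continuous_inner_x t).intervalIntegrable _ _)
    ((hg.continuous_inner_x t).intervalIntegrable _ _)]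
  congr 1
  ext x
  exact intervalIntegral.integral_sub ((hf.continuous_y x t).intervalIntegrable _ _)
    ((hg.continuous_y x t).intervalIntegrable _ _)

theorem intO_const_mul (c : ℝ) (f : OF) (t : ℝ) :
    intO (fun x y s => c * f x y s) t = c * intO f t := by
  simp only [intO, intervalIntegral.integral_const_mul]

theorem intO_mono (hf : SmoothO f) (hg : SmoothO g) {t : ℝ}
    (h : ∀ x, ∀ y ∈ Set.Ioo (0:ℝ) 1, f x y t ≤ g x y t) : intO f t ≤ intO g t := by
  refine intervalIntegral.integral_mono_on zero_le_one
    ((hf.continuous_inner_x t).intervalIntegrable _ _)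
    ((hg.continuous_inner_x t).intervalIntegrable _ _) fun x _ => ?_
  exact intervalIntegral.integral_mono_on_of_le_Ioo zero_le_one
    ((hf.continuous_y x t).intervalIntegrable _ _)
    ((hg.continuous_y x t).intervalIntegrable _ _) fun y hy => h x y hy

theorem intO_pdx (hf : SmoothO f) (t : ℝ) : intO (pdx f) t = 0 := by
  have hc : Continuous (Function.uncurry fun x y => pdx f x y t) :=
    hf.pdx.continuous.comp
      (by fun_prop : Continuous fun q : ℝ × ℝ => ((q.1, q.2, t) : ℝ × ℝ × ℝ))
  have hcx : ∀ y, Continuous fun x => pdx f x y t := fun y =>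
    hc.comp (by fun_prop : Continuous fun x : ℝ => ((x, y) : ℝ × ℝ))
  unfold intO
  rw [intervalIntegral_swap_of_continuous hc]
  have h : ∀ y, ∫ x in (0:ℝ)..1, pdx f x y t = 0 := fun y => by
    rw [intervalIntegral.integral_eq_sub_of_hasDerivAt
      (fun x _ => hf.hasDerivAt_x x y t) ((hcx y).intervalIntegrable _ _)]
    have := hf.periodic 0 y t
    rw [zero_add] at this
    rw [this, sub_self]
  simp [h]

theorem intO_pdy (hf : SmoothO f) (t : ℝ) :
    intO (pdy f) t = intO (fun x _ s => f x 1 s - f x 0 s) t := by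
  unfold intO
  congr 1
  ext x
  rw [intervalIntegral.integral_eq_sub_of_hasDerivAt
    (fun y _ => hf.hasDerivAt_y x y t) ((hf.pdy.continuous_y x t).intervalIntegrable _ _)]
  simp

theorem hasDerivAt_intO (hf : SmoothO f) (t : ℝ) :
    HasDerivAt (intO f) (intO (pdt f) t) t := by
  have h : ∀ x s, HasDerivAt (fun s => ∫ y in (0:ℝ)..1, f x y s)
      (∫ y in (0:ℝ)..1, pdt f x y s) s := fun x s =>
    hasDerivAt_intervalIntegral_of_continuous (f := fun y s => f x y s)
      (f' := fun y s => pdt f x y s)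
      (fun s => hf.continuous_y x s)
      (hf.pdt.continuous.comp
        (by fun_prop : Continuous fun q : ℝ × ℝ => ((x, q.1, q.2) : ℝ × ℝ × ℝ)))
      (fun y s => hf.hasDerivAt_t x y s) s
  exact hasDerivAt_intervalIntegral_of_continuous
    (f := fun x s => ∫ y in (0:ℝ)..1, f x y s) (f' := fun x s => ∫ y in (0:ℝ)..1, pdt f x y s)
    (fun s => hf.continuous_inner_x s) hf.pdt.continuous_inner h t

theorem nO_eq_intO (f : OF) (t : ℝ) : nO f t = intO (fun x y s => f x y s ^ 2) t := rfl

theorem ipO_eq_intO (f g : OF) (t : ℝ) :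
    ipO f g t = intO (fun x y s => f x y s * g x y s) t := rfl

theorem nG_eq_intO (g : GF) (t : ℝ) : nG g t = intO (fun x _ s => g x s ^ 2) t := by
  simp [nG, intO]

theorem ipG_eq_intO (f g : GF) (t : ℝ) :
    ipG f g t = intO (fun x _ s => f x s * g x s) t := by
  simp [ipG, intO]

theorem deriv_intO (hf : SmoothO f) (t : ℝ) :
    deriv (fun s => intO f s) t = intO (pdt f) t :=
  (hasDerivAt_intO hf t).deriv

end Integral

section Leibniz

variable {f g : OF}

theorem pdx_add (hf : SmoothO f) (hg : SmoothO g) (x y t : ℝ) :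
    pdx (fun x y t => f x y t + g x y t) x y t = pdx f x y t + pdx g x y t :=
  ((hf.hasDerivAt_x x y t).add (hg.hasDerivAt_x x y t)).deriv

theorem pdx_sub (hf : SmoothO f) (hg : SmoothO g) (x y t : ℝ) :
    pdx (fun x y t => f x y t - g x y t) x y t = pdx f x y t - pdx g x y t :=
  ((hf.hasDerivAt_x x y t).sub (hg.hasDerivAt_x x y t)).deriv

theorem pdx_mul (hf : SmoothO f) (hg : SmoothO g) (x y t : ℝ) :
    pdx (fun x y t => f x y t * g x y t) x y t =
      pdx f x y t * g x y t + f x y t * pdx g x y t :=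
  ((hf.hasDerivAt_x x y t).mul (hg.hasDerivAt_x x y t)).deriv

theorem pdx_const (c x y t : ℝ) : pdx (fun _ _ _ => c) x y t = 0 :=
  deriv_const _ c

theorem pdy_add (hf : SmoothO f) (hg : SmoothO g) (x y t : ℝ) :
    pdy (fun x y t => f x y t + g x y t) x y t = pdy f x y t + pdy g x y t :=
  ((hf.hasDerivAt_y x y t).add (hg.hasDerivAt_y x y t)).deriv

theorem pdy_sub (hf : SmoothO f) (hg : SmoothO g) (x y t : ℝ) :
    pdy (fun x y t => f x y t - g x y t) x y t = pdy f x y t - pdy g x y t :=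
  ((hf.hasDerivAt_y x y t).sub (hg.hasDerivAt_y x y t)).deriv

theorem pdy_mul (hf : SmoothO f) (hg : SmoothO g) (x y t : ℝ) :
    pdy (fun x y t => f x y t * g x y t) x y t =
      pdy f x y t * g x y t + f x y t * pdy g x y t :=
  ((hf.hasDerivAt_y x y t).mul (hg.hasDerivAt_y x y t)).deriv

theorem pdy_const (c x y t : ℝ) : pdy (fun _ _ _ => c) x y t = 0 :=
  deriv_const _ c

theorem pdt_add (hf : SmoothO f) (hg : SmoothO g) (x y t : ℝ) :
    pdt (fun x y t => f x y t + g x y t) x y t = pdt f x y t + pdt g x y t :=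
  ((hf.hasDerivAt_t x y t).add (hg.hasDerivAt_t x y t)).deriv

theorem pdt_mul (hf : SmoothO f) (hg : SmoothO g) (x y t : ℝ) :
    pdt (fun x y t => f x y t * g x y t) x y t =
      pdt f x y t * g x y t + f x y t * pdt g x y t :=
  ((hf.hasDerivAt_t x y t).mul (hg.hasDerivAt_t x y t)).deriv

theorem pdt_sq (hf : SmoothO f) (x y t : ℝ) :
    pdt (fun x y t => f x y t ^ 2) x y t = 2 * f x y t * pdt f x y t :=
  ((hf.hasDerivAt_t x y t).fun_pow 2).deriv.trans (by simp [pdt])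

theorem pdt_const (c x y t : ℝ) : pdt (fun _ _ _ => c) x y t = 0 :=
  deriv_const _ c

theorem pdx_coord_y (x y t : ℝ) : pdx (fun _ y _ => y) x y t = 0 :=
  deriv_const x y

theorem pdy_coord_y (x y t : ℝ) : pdy (fun _ y _ => y) x y t = 1 :=
  deriv_id y

theorem pdy_boundary (g : GF) (x y t : ℝ) : pdy (fun x _ t => g x t) x y t = 0 :=
  deriv_const y (g x t)

end Leibniz


/-- **Proposition 3.1 (basic energy estimate).**  There is `R₀ > 0` (depending only on
the Korn constant `K`) such that for `0 < R ≤ R₀` every sufficiently smooth solution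
`(η,u,v,p)` of the transformed system satisfies
`(δ/2) d/dt { ‖u^δ‖² + (2/R)((1/tan α)|η|₀² + (δ²W/sin α)|η_x|₀²) }
  + (1/(4KR)) ‖∇_δ u^δ‖²
  ≤ (4K/R)(|η|₀² + |b₃η|₀²) + (1/R)(h₁,u)_Γ − (2/R)(h₂,δv)_Γ
    + (2/R)((1/tan α)η − (δ²W/sin α)η_{xx}, δh₃)_Γ + (F₁,u^δ)_Ω`,
with `F₁ = f − (2/R)A₄∇_δ p + (1/R)(b₂u_{yy},0)ᵀ`. -/
theorem basic_energy_estimate (K : ℝ) (hK : KornConst K) :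
    ∃ R₀ : ℝ, 0 < R₀ ∧
      ∀ δ : ℝ, δ ∈ Set.Ioc (0:ℝ) 1 →
      ∀ R : ℝ, 0 < R → R ≤ R₀ →
      ∀ W : ℝ, 0 < W →
      ∀ α : ℝ, α ∈ Set.Ioo (0:ℝ) (π/2) →
      ∀ (η : GF) (u v p : OF) (a11 a12 a22 b2 f1 f2 : OF) (b3 h1 h2 h3 : GF),
        FilmSystem δ R W α η u v p a11 a12 a22 b2 f1 f2 b3 h1 h2 h3 →
        ∀ t : ℝ,
          (δ/2) * deriv (fun s =>
              nO u s + δ^2 * nO v s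
                + (2/R) * ((1/Real.tan α) * nG η s
                  + (δ^2 * W / Real.sin α) * nG (gdx η) s)) t
            + (1/(4*K*R)) * (δ^2 * nO (pdx u) t + nO (pdy u) t
                + δ^4 * nO (pdx v) t + δ^2 * nO (pdy v) t)
          ≤ (4*K/R) * (nG η t + nG (fun x s => b3 x s * η x s) t)
            + (1/R) * ipG h1 (tr u) t
            - (2/R) * ipG h2 (fun x s => δ * v x 1 s) t
            + (2/R) * ipG (fun x s => (1/Real.tan α) * η x s
                - (δ^2 * W / Real.sin α) * gdxn 2 η x s) (fun x s => δ * h3 x s) t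
            + (ipO (fun x y s => f1 x y s
                  - (2/R) * (a11 x y s * (δ * pdx p x y s) + a12 x y s * pdy p x y s)
                  + (1/R) * (b2 x y s * pdyn 2 u x y s)) u t
              + ipO (fun x y s => f2 x y s
                  - (2/R) * (a12 x y s * (δ * pdx p x y s) + a22 x y s * pdy p x y s))
                  (fun x y s => δ * v x y s) t) := by
  obtain ⟨hK0, hKorn⟩ := hK
  refine ⟨1 / (16 * K), by positivity, ?_⟩
  intro δ hδ R hR hRR W hW α hα η u v p a11 a12 a22 b2 f1 f2 b3 h1 h2 h3 h t
  have hkorn := hKorn δ hδ u v h.smooth_u h.smooth_v h.incompr h.noslip t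
  have hu := h.smooth_u
  have hv := h.smooth_v
  have hp := h.smooth_p
  have ha11 := h.smooth_a11
  have ha12 := h.smooth_a12
  have ha22 := h.smooth_a22
  have hb2 := h.smooth_b2
  have hf1 := h.smooth_f1
  have hf2 := h.smooth_f2
  have he := SmoothO.of_boundary h.smooth_η
  have hex : SmoothO fun x _ t => gdx η x t := he.pdx
  have hexx : SmoothO fun x _ t => gdxn 2 η x t := he.pdx.pdx
  have het : SmoothO fun x _ t => gdt η x t := he.pdt
  have hb3 := SmoothO.of_boundary h.smooth_b3
  have hh1 := SmoothO.of_boundary h.smooth_h1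
  have hh2 := SmoothO.of_boundary h.smooth_h2
  have hh3 := SmoothO.of_boundary h.smooth_h3
  have hu1 := hu.trace 1
  have hv1 := hv.trace 1
  have hux := hu.pdx
  have huy := hu.pdy
  have hut := hu.pdt
  have hvx := hv.pdx
  have hvy := hv.pdy
  have hvt := hv.pdt
  have hpx := hp.pdx
  have hpy := hp.pdy
  have huxx : SmoothO (pdxn 2 u) := hux.pdx
  have huyy : SmoothO (pdyn 2 u) := huy.pdy
  have hvxx : SmoothO (pdxn 2 v) := hvx.pdx
  have hvyy : SmoothO (pdyn 2 v) := hvy.pdy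
  have hbc2 := fun x => h.bc2 x t
  generalize 1 / Real.tan α = τ at *
  generalize δ ^ 2 * W / Real.sin α = σ at *
  obtain ⟨A, hAdef⟩ : ∃ A : OF, A = fun x y t =>
    (2 * δ / R) * (σ * (gdx η x t * gdx η x t) * (1 / 2) + σ * (gdx η x t * gdt η x t)
        - τ * (η x t * η x t) * (1 / 2))
      - ((2 * y - y * y) * (δ / 2) * (u x y t * u x y t + δ ^ 2 * (v x y t * v x y t))
        + (2 / R) * δ * (p x y t * u x y t)
        - (1 / R) * (2 * δ ^ 2 * (pdx u x y t * u x y t)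
          + (pdy u x y t + δ ^ 2 * pdx v x y t) * (δ ^ 2 * v x y t))) := ⟨_, rfl⟩
  obtain ⟨B, hBdef⟩ : ∃ B : OF, B = fun x y t =>
    2 * ((y - 1) * (u x y t * u x y t + δ ^ 2 * (v x y t * v x y t)))
      - 5 / (8 * K * R) * (u x 1 t * u x y t)
      - ((2 / R) * δ * (p x y t * v x y t)
        - (1 / R) * ((pdy u x y t + δ ^ 2 * pdx v x y t) * u x y t
          + 2 * δ ^ 2 * (pdy v x y t * v x y t))) := ⟨_, rfl⟩
  have hA : SmoothO A := by
    subst hAdef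
    repeat' with_reducible
      first
      | exact SmoothO.const _ | assumption | apply SmoothO.sub | apply SmoothO.add
      | apply SmoothO.mul | apply SmoothO.pow | exact SmoothO.coord_y
  have hB : SmoothO B := by
    subst hBdef
    repeat' with_reducible
      first
      | exact SmoothO.const _ | assumption | apply SmoothO.sub | apply SmoothO.add
      | apply SmoothO.mul | apply SmoothO.pow | exact SmoothO.coord_y
  have hAx := intO_pdx hA t
  have hBy := intO_pdy hB t
  suffices hs : (δ/2) * deriv (fun s =>
              nO u s + δ^2 * nO v s
                + (2/R) * (τ * nG η s
                  + σ * nG (gdx η) s)) t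
            + (1/(4*K*R)) * (δ^2 * nO (pdx u) t + nO (pdy u) t
                + δ^4 * nO (pdx v) t + δ^2 * nO (pdy v) t)
            + (1 / (K * R)) * (K * (2 * δ^2 * nO (pdx u) t
          + nO (fun x y s => pdy u x y s + δ^2 * pdx v x y s) t
          + 2 * δ^2 * nO (pdy v) t) - (δ^2 * nO (pdx u) t + nO (pdy u) t + δ^4 * nO (pdx v) t
            + δ^2 * nO (pdy v) t))
          ≤ (4*K/R) * (nG η t + nG (fun x s => b3 x s * η x s) t)
            + (1/R) * ipG h1 (tr u) t
            - (2/R) * ipG h2 (fun x s => δ * v x 1 s) t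
            + (2/R) * ipG (fun x s => τ * η x s
                - σ * gdxn 2 η x s) (fun x s => δ * h3 x s) t
            + (ipO (fun x y s => f1 x y s
                  - (2/R) * (a11 x y s * (δ * pdx p x y s) + a12 x y s * pdy p x y s)
                  + (1/R) * (b2 x y s * pdyn 2 u x y s)) u t
              + ipO (fun x y s => f2 x y s
                  - (2/R) * (a12 x y s * (δ * pdx p x y s) + a22 x y s * pdy p x y s))
                  (fun x y s => δ * v x y s) t)
            + intO (pdx A) t + (intO (pdy B) t - intO (fun x _ s => B x 1 s - B x 0 s) t) by
    have hpos : 0 ≤ (1 / (K * R)) * (K * (2 * δ^2 * nO (pdx u) t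
          + nO (fun x y s => pdy u x y s + δ^2 * pdx v x y s) t
          + 2 * δ^2 * nO (pdy v) t) - (δ^2 * nO (pdx u) t + nO (pdy u) t + δ^4 * nO (pdx v) t
            + δ^2 * nO (pdy v) t)) :=
      mul_nonneg (by positivity) (sub_nonneg.2 hkorn)
    rw [hAx, hBy, sub_self, add_zero, add_zero] at hs
    linarith
  have hett := he.pdt
  have hext := hex.pdt
  have hAs := hA.pdx
  have hBs := hB.pdy
  have hB0 := (hB.trace 1).sub (hB.trace 0)
  simp (disch := (repeat' with_reducible
                    first
                    | exact SmoothO.const _ | assumption | apply SmoothO.sub | apply SmoothO.add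
                    | apply SmoothO.mul | apply SmoothO.pow | exact SmoothO.coord_y)) only
    [nO_eq_intO, nG_eq_intO, ipO_eq_intO, ipG_eq_intO, tr,
    ← intO_const_mul, ← intO_add, ← intO_sub, deriv_intO, pdt_add, pdt_mul,
    pdt_sq, pdt_const]
  refine intO_mono ?_ ?_ ?_
  · repeat' with_reducible
      first
      | exact SmoothO.const _ | assumption | apply SmoothO.sub | apply SmoothO.add
      | apply SmoothO.mul | apply SmoothO.pow
  · repeat' with_reducible
      first
      | exact SmoothO.const _ | assumption | apply SmoothO.sub | apply SmoothO.add
      | apply SmoothO.mul | apply SmoothO.pow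
  intro x y hy
  have hηx : pdx (fun x _ => η x) x y t = gdx η x t := rfl
  have hηxx : pdx (fun x _ => gdx η x) x y t = gdxn 2 η x t := rfl
  have hηt : pdt (fun x _ => η x) x y t = gdt η x t := rfl
  have hηxt : pdx (fun x _ => gdt η x) x y t = pdt (fun x _ => gdx η x) x y t :=
    (he.pdt_pdx x y t).symm
  have huxx' : pdx (pdx u) x y t = pdxn 2 u x y t := rfl
  have hvxx' : pdx (pdx v) x y t = pdxn 2 v x y t := rfl
  have huyy' : pdy (pdy u) x y t = pdyn 2 u x y t := rfl
  have hvyy' : pdy (pdy v) x y t = pdyn 2 v x y t := rfl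
  have hincx : pdxn 2 u x y t + pdx (pdy v) x y t = 0 := by
    have hd := (hux.hasDerivAt_x x y t).add (hvy.hasDerivAt_x x y t)
    refine hd.unique ((hasDerivAt_const x (0:ℝ)).congr_of_eventuallyEq ?_)
    exact Filter.Eventually.of_forall fun s => h.incompr s t y hy
  have hincy : pdx (pdy u) x y t + pdyn 2 v x y t = 0 := by
    have hd := (hux.hasDerivAt_y x y t).add (hvy.hasDerivAt_y x y t)
    rw [hu.pdy_pdx] at hd
    refine hd.unique ((hasDerivAt_const y (0:ℝ)).congr_of_eventuallyEq ?_)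
    filter_upwards [isOpen_Ioo.mem_nhds hy] with s hs
    exact h.incompr x t s hs
  have hB0 : B x 0 t = 0 := by
    rw [hBdef]
    simp [(h.noslip x t).1, (h.noslip x t).2]
  rw [hB0]
  have hκ : 16 ≤ 1 / (K * R) := by
    rw [le_div_iff₀ (by positivity)] at hRR ⊢
    linarith
  have hKK : K * K⁻¹ = 1 := mul_inv_cancel₀ hK0.ne'
  have hs : 0 ≤ 1 - (1 - y) ^ 2 := by nlinarith [hy.1, hy.2]
  have q1 : 0 ≤ (1 / R) * (1 / (4 * K)) * (4 * K * η x t - u x 1 t) ^ 2 := by positivity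
  have q2 : 0 ≤ (1 / R) * (1 / (16 * K)) * (8 * K * (b3 x t * η x t) - u x 1 t) ^ 2 := by
    positivity
  have q3 : 0 ≤ (1 / (K * R)) * (pdy u x y t - u x 1 t) ^ 2 := by positivity
  have q4 : ∀ w w' : ℝ, 0 ≤ (2 * w' - (1 - y) * w) ^ 2 + (1 - (1 - y) ^ 2) * w ^ 2 :=
    fun w w' => by positivity
  have q5 : 0 ≤ ((1 - y) * u x y t + δ * v x y t) ^ 2 + (1 - (1 - y) ^ 2) * u x y t ^ 2 := by
    positivity
  have q6 : 0 ≤ (7 / 16 * (1 / (K * R)) - 4) * pdy u x y t ^ 2 :=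
    mul_nonneg (by linarith) (sq_nonneg _)
  have q7 : 0 ≤ (3 / 4 * (1 / (K * R)) - 4) * (δ * pdy v x y t) ^ 2 :=
    mul_nonneg (by linarith) (sq_nonneg _)
  have q8 : 0 ≤ (1 / (K * R)) * ((δ * pdx u x y t) ^ 2 + (δ ^ 2 * pdx v x y t) ^ 2) := by
    positivity
  rw [hAdef, hBdef]
  simp (disch := (repeat' with_reducible
                    first
                    | exact SmoothO.const _ | assumption | apply SmoothO.sub | apply SmoothO.add
                    | apply SmoothO.mul | apply SmoothO.pow | exact SmoothO.coord_y)) only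
    [pdx_add, pdx_mul, pdx_sub, pdx_const, pdx_coord_y,
    pdy_add, pdy_mul, pdy_sub, pdy_const, pdy_coord_y, pdy_boundary, hηx, hηxx, hηt, hηxt,
    huxx', hvxx', huyy', hvyy', hv.pdy_pdx]
  linear_combination q1 + q2 + 5 / 16 * q3 + q4 (u x y t) (pdy u x y t)
    + δ ^ 2 * q4 (v x y t) (pdy v x y t) + q5 + q6 + q7 + 3 / 4 * q8
    + u x y t * h.mom1 x t y hy + δ * v x y t * h.mom2 x t y hy
    + 2 / R * δ * p x y t * h.incompr x t y hy
    - 1 / R * δ ^ 2 * u x y t * hincx - 1 / R * δ ^ 2 * v x y t * hincy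
    + u x 1 t / R * h.bc1 x t - 2 / R * δ * v x 1 t * hbc2 x
    + 2 / R * δ * (τ * η x t - σ * gdxn 2 η x t) * h.bc3 x t
    + (2 * δ^2 * pdx u x y t ^ 2 + (pdy u x y t + δ^2 * pdx v x y t) ^ 2
          + 2 * δ^2 * pdy v x y t ^ 2 + 4 * K * η x t ^ 2 + 4 * K * (b3 x t * η x t) ^ 2
          - (2 + b3 x t) * η x t * u x 1 t) / R * hKK
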